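/- Let E ⊂ ℝ be a Borel set and let μ be a positive Borel measure that is reflectionless on E (μ ∈ R(E)). Then the singular part μ_s of μ is supported by the set {x ∈ ℝ : lim_{h→0+} |E ∩ (x−h, x+h)|/(2h) = 0}; that is, μ_s gives zero mass to the complement of this set. -/

import Mathlib

open MeasureTheory Filter Topology

/-- The Herglotz function associated with a positive Borel measure `μ` on `ℝ`
(satisfying `∫ dμ(t)/(t²+1) < ∞`) and constants `a ∈ ℝ`, `b ≥ 0`:
`F(z) = a + b z + ∫ (1/(t - z) - t/(t² + 1)) dμ(t)`. -/
noncomputable def herglotzFn (μ : Measure ℝ) (a b : ℝ) (z : ℂ) : ℂ :=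
  (a : ℂ) + (b : ℂ) * z +
    ∫ t : ℝ, (((t : ℂ) - z)⁻¹ - (t : ℂ) / ((t : ℂ) ^ 2 + 1)) ∂μ

/-- `μ ∈ R(E)`: the measure `μ` satisfies `∫ dμ(t)/(t²+1) < ∞` and for some choice of
`a ∈ ℝ`, `b ≥ 0` the associated Herglotz function `F_μ` is reflectionless on `E`, i.e.
its boundary value has vanishing real part at Lebesgue-a.e. point of `E`. -/
def IsReflectionless (μ : Measure ℝ) (E : Set ℝ) : Prop :=
  Integrable (fun t : ℝ => (t ^ 2 + 1)⁻¹) μ ∧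
  ∃ a b : ℝ, 0 ≤ b ∧
    ∀ᵐ t : ℝ ∂(volume.restrict E),
      Tendsto (fun y : ℝ => (herglotzFn μ a b ((t : ℂ) + y * Complex.I)).re)
        (𝓝[>] (0 : ℝ)) (𝓝 0)

/-- The (unnormalized) Poisson kernel of the upper half plane. -/
noncomputable def halfPlanePoisson (y u : ℝ) : ℝ := y / (u ^ 2 + y ^ 2)

lemma halfPlanePoisson_nonneg {y : ℝ} (hy : 0 < y) (u : ℝ) : 0 ≤ halfPlanePoisson y u := by
  unfold halfPlanePoisson; positivity

@[fun_prop]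
lemma continuous_halfPlanePoisson {y : ℝ} (hy : 0 < y) : Continuous (halfPlanePoisson y) := by
  unfold halfPlanePoisson
  exact continuous_const.div (by fun_prop) fun u => by positivity

@[fun_prop]
lemma measurable_halfPlanePoisson (y : ℝ) : Measurable (halfPlanePoisson y) := by
  unfold halfPlanePoisson; fun_prop

lemma halfPlanePoisson_eq {y : ℝ} (hy : 0 < y) (u : ℝ) :
    halfPlanePoisson y u = y⁻¹ * (1 + (u / y) ^ 2)⁻¹ := by
  unfold halfPlanePoisson
  field_simp
  ring

lemma integrable_halfPlanePoisson_sub {y : ℝ} (hy : 0 < y) (x : ℝ) :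
    Integrable fun t => halfPlanePoisson y (t - x) := by
  simp_rw [halfPlanePoisson_eq hy]
  exact ((integrable_inv_one_add_sq.comp_div hy.ne').comp_sub_right x).const_mul _

lemma integral_halfPlanePoisson_sub {y : ℝ} (hy : 0 < y) (x : ℝ) :
    ∫ t, halfPlanePoisson y (t - x) = Real.pi := by
  rw [integral_sub_right_eq_self (halfPlanePoisson y) x]
  simp_rw [halfPlanePoisson_eq hy]
  rw [integral_const_mul, Measure.integral_comp_div (fun u => (1 + u ^ 2)⁻¹) y,
    integral_univ_inv_one_add_sq, abs_of_pos hy, smul_eq_mul]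
  field_simp

/-- **Poisson formula** on a horizontal line for bounded holomorphic functions on the upper
half plane. -/
lemma integral_halfPlanePoisson_smul_of_bounded {g : ℂ → ℂ} {C : ℝ}
    (hg : DifferentiableOn ℂ g {z | 0 < z.im}) (hC : ∀ z : ℂ, 0 < z.im → ‖g z‖ ≤ C)
    (x : ℝ) {h η : ℝ} (hh : 0 < h) (hη : 0 < η) :
    ∫ t : ℝ, (halfPlanePoisson h (t - x) : ℂ) * g (t + η * Complex.I) =
      Real.pi * g (x + (η + h : ℝ) * Complex.I) := by
  set z₀ : ℂ := x + (η + h : ℝ) * Complex.I with hz₀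
  set z₁ : ℂ := x + (η - h : ℝ) * Complex.I with hz₁
  have hz₀re : z₀.re = x := by simp [hz₀]
  have hz₀im : z₀.im = η + h := by simp [hz₀]
  have hz₁re : z₁.re = x := by simp [hz₁]
  have hz₁im : z₁.im = η - h := by simp [hz₁]
  have hU : IsOpen {z : ℂ | 0 < z.im} := isOpen_lt continuous_const Complex.continuous_im
  have hC0 : 0 ≤ C := (norm_nonneg _).trans (hC Complex.I (by simp))
  have hz₀U : z₀ ∈ {z : ℂ | 0 < z.im} := by simp [hz₀]; positivity
  let f : ℂ → ℂ := fun z => dslope g z₀ z / (z - z₁)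
  have hz₁ne : ∀ z : ℂ, η ≤ z.im → z - z₁ ≠ 0 := by
    intro z hz h0
    have := congrArg Complex.im h0
    simp [hz₁] at this
    linarith
  have hdiff : DifferentiableOn ℂ f {z | η ≤ z.im} := by
    refine DifferentiableOn.div ?_ (by fun_prop) hz₁ne
    exact ((Complex.differentiableOn_dslope (hU.mem_nhds hz₀U)).2 hg).mono
      fun z hz => lt_of_lt_of_le hη hz
  have hline : ∀ t : ℝ, f (t + η * Complex.I) =
      (g (t + η * Complex.I) - g z₀) / ((t - x) ^ 2 + h ^ 2 : ℝ) := by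
    intro t
    have hne : (t + η * Complex.I : ℂ) ≠ z₀ := by
      intro h0
      have := congrArg Complex.im h0
      simp [hz₀] at this
      linarith
    simp only [f]
    rw [dslope_of_ne _ hne, slope_def_field, div_div]
    congr 1
    simp only [hz₀, hz₁]
    push_cast
    linear_combination (-(h : ℂ) ^ 2) * Complex.I_sq
  have hint : Integrable fun t : ℝ => f (t + η * Complex.I) := by
    refine Integrable.mono' ((integrable_halfPlanePoisson_sub hh x).const_mul (2 * C / h)) ?_ ?_
    · refine Continuous.aestronglyMeasurable ?_
      exact hdiff.continuousOn.comp_continuous (by fun_prop) (fun t => by simp)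
    · refine Eventually.of_forall fun t => ?_
      rw [hline, norm_div, Complex.norm_real, Real.norm_eq_abs,
        abs_of_pos (by positivity)]
      have : ‖g (t + η * Complex.I) - g z₀‖ ≤ 2 * C := by
        refine (norm_sub_le _ _).trans ?_
        have := hC (t + η * Complex.I) (by simpa using hη)
        have := hC z₀ hz₀U
        linarith
      calc _ ≤ 2 * C / ((t - x) ^ 2 + h ^ 2) := by gcongr
        _ = _ := by unfold halfPlanePoisson; field_simp
  have hfar : ∀ R : ℝ, 2 * h ≤ R → ∀ z : ℂ, η ≤ z.im →
      (R ≤ |z.re - x| ∨ η + R ≤ z.im) → ‖f z‖ ≤ 4 * C / R ^ 2 := by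
    intro R hR z hz hor
    have hRpos : 0 < R := by linarith
    have h0 : R / 2 ≤ ‖z - z₀‖ := by
      rcases hor with h1 | h1
      · have := Complex.abs_re_le_norm (z - z₀)
        simp only [Complex.sub_re, hz₀re] at this
        linarith
      · have := (le_abs_self _).trans (Complex.abs_im_le_norm (z - z₀))
        simp only [Complex.sub_im, hz₀im] at this
        linarith
    have h1 : R ≤ ‖z - z₁‖ := by
      rcases hor with h1 | h1
      · have := Complex.abs_re_le_norm (z - z₁)
        simp only [Complex.sub_re, hz₁re] at this
        linarith
      · have := (le_abs_self _).trans (Complex.abs_im_le_norm (z - z₁))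
        simp only [Complex.sub_im, hz₁im] at this
        linarith
    have hne : z ≠ z₀ := by
      rintro rfl
      simp at h0; linarith
    simp only [f]
    rw [dslope_of_ne _ hne, slope_def_field, norm_div, norm_div]
    have h2 : ‖g z - g z₀‖ ≤ 2 * C := by
      refine (norm_sub_le _ _).trans ?_
      have := hC z (by linarith)
      have := hC z₀ hz₀U
      linarith
    calc _ ≤ 2 * C / (R / 2) / R := by gcongr
      _ = _ := by field_simp; ring
  have hzero : ∫ t : ℝ, f (t + η * Complex.I) = 0 := by
    have hlim := intervalIntegral_tendsto_integral hint
      (tendsto_atBot_add_const_left atTop x tendsto_neg_atTop_atBot)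
      (tendsto_atTop_add_const_left atTop x tendsto_id)
    refine tendsto_nhds_unique hlim ?_
    refine squeeze_zero_norm' (a := fun R : ℝ => 16 * C / R) ?_
      (tendsto_const_nhds.div_atTop tendsto_id)
    filter_upwards [eventually_ge_atTop (2 * h)] with R hR
    have hRpos : 0 < R := by linarith
    have hrect := Complex.integral_boundary_rect_eq_zero_of_differentiableOn f
      (⟨x + -R, η⟩ : ℂ) (⟨x + R, η + R⟩ : ℂ) (hdiff.mono (by
        intro z hz
        have := hz.2
        simp only [Set.mem_preimage, Set.uIcc_of_le (show η ≤ η + R by linarith)] at this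
        exact this.1))
    simp only [id] at hrect ⊢
    have e1 : ‖∫ t : ℝ in (x + -R)..(x + R), f (t + (η + R : ℝ) * Complex.I)‖ ≤
        4 * C / R ^ 2 * |x + R - (x + -R)| := by
      refine intervalIntegral.norm_integral_le_of_norm_le_const fun t _ => ?_
      exact hfar R hR _ (by simp; linarith) (Or.inr (by simp))
    have e2 : ‖∫ y : ℝ in η..(η + R), f ((x + R : ℝ) + y * Complex.I)‖ ≤
        4 * C / R ^ 2 * |η + R - η| := by
      refine intervalIntegral.norm_integral_le_of_norm_le_const fun t ht => ?_
      rw [Set.uIoc_of_le (by linarith)] at ht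
      exact hfar R hR _ (by simpa using ht.1.le) (Or.inl (by simp [abs_of_pos hRpos]))
    have e3 : ‖∫ y : ℝ in η..(η + R), f ((x + -R : ℝ) + y * Complex.I)‖ ≤
        4 * C / R ^ 2 * |η + R - η| := by
      refine intervalIntegral.norm_integral_le_of_norm_le_const fun t ht => ?_
      rw [Set.uIoc_of_le (by linarith)] at ht
      exact hfar R hR _ (by simpa using ht.1.le) (Or.inl (by simp [abs_of_pos hRpos]))
    rw [show x + R - (x + -R) = 2 * R by ring, abs_of_pos (by positivity)] at e1
    rw [show η + R - η = R by ring, abs_of_pos hRpos] at e2 e3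
    set A := ∫ t : ℝ in (x + -R)..(x + R), f (t + (η + R : ℝ) * Complex.I)
    set B := ∫ y : ℝ in η..(η + R), f ((x + R : ℝ) + y * Complex.I)
    set D := ∫ y : ℝ in η..(η + R), f ((x + -R : ℝ) + y * Complex.I)
    have : (∫ t : ℝ in (x + -R)..(x + R), f (t + η * Complex.I)) =
        A - Complex.I • B + Complex.I • D := by
      linear_combination hrect
    rw [this]
    calc ‖A - Complex.I • B + Complex.I • D‖ ≤ ‖A‖ + ‖B‖ + ‖D‖ := by
          refine (norm_add_le _ _).trans ?_
          refine (add_le_add_left (norm_sub_le _ _) _).trans ?_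
          simp
      _ ≤ 4 * C / R ^ 2 * (2 * R) + 4 * C / R ^ 2 * R + 4 * C / R ^ 2 * R := by gcongr
      _ = _ := by field_simp; ring
  have hK : Integrable fun t : ℝ => (halfPlanePoisson h (t - x) : ℂ) :=
    (integrable_halfPlanePoisson_sub hh x).ofReal
  have hsplit : ∀ t : ℝ, (halfPlanePoisson h (t - x) : ℂ) * g (t + η * Complex.I) =
      (h : ℂ) * f (t + η * Complex.I) + (halfPlanePoisson h (t - x) : ℂ) * g z₀ := by
    intro t
    rw [hline]
    unfold halfPlanePoisson
    push_cast
    ring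
  simp_rw [hsplit]
  rw [integral_add (hint.const_mul (h : ℂ)) (hK.mul_const (g z₀)), integral_const_mul, hzero,
    integral_mul_const]
  have := integral_halfPlanePoisson_sub hh x
  rw [integral_complex_ofReal, this]
  simp

lemma norm_herglotz_kernel_le {z : ℂ} (hz : 0 < z.im) (t : ℝ) :
    ‖((t : ℂ) - z)⁻¹ - (t : ℂ) / ((t : ℂ) ^ 2 + 1)‖ ≤
      (‖z‖ + (1 + ‖z‖ ^ 2) / z.im) * (t ^ 2 + 1)⁻¹ := by
  have h0 : (t : ℂ) - z ≠ 0 := fun h => by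
    have := congrArg Complex.im h
    simp at this
    exact hz.ne' this
  have h1 : ((t : ℂ) ^ 2 + 1) ≠ 0 := by
    have : (0 : ℝ) < t ^ 2 + 1 := by positivity
    exact_mod_cast this.ne'
  have him : z.im ≤ ‖(t : ℂ) - z‖ := by
    have := (neg_le_abs _).trans (Complex.abs_im_le_norm ((t : ℂ) - z))
    simpa using this
  have hsplit : ((t : ℂ) - z)⁻¹ - (t : ℂ) / ((t : ℂ) ^ 2 + 1) =
      (z + (1 + z ^ 2) / ((t : ℂ) - z)) * ((t ^ 2 + 1 : ℝ) : ℂ)⁻¹ := by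
    push_cast
    field_simp
    ring
  rw [hsplit, norm_mul, norm_inv, Complex.norm_real, Real.norm_eq_abs,
    abs_of_pos (show (0 : ℝ) < t ^ 2 + 1 by positivity)]
  gcongr
  refine (norm_add_le _ _).trans ?_
  rw [norm_div]
  gcongr
  refine (norm_add_le _ _).trans ?_
  simp

lemma integrable_herglotz_kernel {μ : Measure ℝ}
    (hμ : Integrable (fun t : ℝ => (t ^ 2 + 1)⁻¹) μ) {z : ℂ} (hz : 0 < z.im) :
    Integrable (fun t : ℝ => ((t : ℂ) - z)⁻¹ - (t : ℂ) / ((t : ℂ) ^ 2 + 1)) μ :=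
  (hμ.const_mul _).mono' (by fun_prop) (Eventually.of_forall (norm_herglotz_kernel_le hz))

lemma im_herglotz_kernel (z : ℂ) (t : ℝ) :
    (((t : ℂ) - z)⁻¹ - (t : ℂ) / ((t : ℂ) ^ 2 + 1)).im = halfPlanePoisson z.im (t - z.re) := by
  have : (t : ℂ) / ((t : ℂ) ^ 2 + 1) = ((t / (t ^ 2 + 1) : ℝ) : ℂ) := by push_cast; ring
  rw [Complex.sub_im, this, Complex.ofReal_im, Complex.inv_im, Complex.normSq_apply]
  simp [halfPlanePoisson, sq]

lemma integrable_halfPlanePoisson_of_integrable {μ : Measure ℝ}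
    (hμ : Integrable (fun t : ℝ => (t ^ 2 + 1)⁻¹) μ) (x : ℝ) {y : ℝ} (hy : 0 < y) :
    Integrable (fun t : ℝ => halfPlanePoisson y (t - x)) μ := by
  have := (integrable_herglotz_kernel hμ (z := ⟨x, y⟩) hy).im
  refine this.congr (Eventually.of_forall fun t => ?_)
  exact im_herglotz_kernel _ t

lemma im_herglotzFn {μ : Measure ℝ} (hμ : Integrable (fun t : ℝ => (t ^ 2 + 1)⁻¹) μ)
    (a b : ℝ) {z : ℂ} (hz : 0 < z.im) :
    (herglotzFn μ a b z).im = b * z.im + ∫ t, halfPlanePoisson z.im (t - z.re) ∂μ := by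
  have h := Complex.imCLM.integral_comp_comm (integrable_herglotz_kernel hμ hz)
  simp only [Complex.imCLM_apply, im_herglotz_kernel] at h
  rw [herglotzFn, Complex.add_im, ← h]
  simp

lemma herglotzFn_differentiableOn {μ : Measure ℝ}
    (hμ : Integrable (fun t : ℝ => (t ^ 2 + 1)⁻¹) μ) (a b : ℝ) :
    DifferentiableOn ℂ (herglotzFn μ a b) {z | 0 < z.im} := by
  intro z₀ hz₀
  replace hz₀ : 0 < z₀.im := hz₀
  refine DifferentiableAt.differentiableWithinAt ?_
  unfold herglotzFn
  refine (by fun_prop : DifferentiableAt ℂ (fun z : ℂ => (a : ℂ) + b * z) z₀).add ?_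
  have hne : ∀ z : ℂ, 0 < z.im → ∀ t : ℝ, (t : ℂ) - z ≠ 0 := fun z hz t h => by
    have := congrArg Complex.im h
    simp at this
    exact hz.ne' this
  have hs : {z : ℂ | z₀.im / 2 < z.im} ∩ {z | ‖z‖ < ‖z₀‖ + 1} ∈ 𝓝 z₀ := by
    refine inter_mem ?_ ?_
    · exact (isOpen_lt continuous_const Complex.continuous_im).mem_nhds (half_lt_self hz₀)
    · exact (isOpen_lt continuous_norm continuous_const).mem_nhds
        (show ‖z₀‖ < ‖z₀‖ + 1 from lt_add_one _)
  refine (hasDerivAt_integral_of_dominated_loc_of_deriv_le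
    (F' := fun z (t : ℝ) => (((t : ℂ) - z) ^ 2)⁻¹)
    (bound := fun t => (2 + (2 * (‖z₀‖ + 1) ^ 2 + 1) / (z₀.im / 2) ^ 2) * (t ^ 2 + 1)⁻¹)
    hs (Eventually.of_forall fun z => by fun_prop) (integrable_herglotz_kernel hμ hz₀)
    (by fun_prop) (Eventually.of_forall fun t z hz => ?_) (hμ.const_mul _)
    (Eventually.of_forall fun t z hz => ?_)).2.differentiableAt
  · have h1 : z₀.im / 2 ≤ ‖(t : ℂ) - z‖ := by
      have := (neg_le_abs _).trans (Complex.abs_im_le_norm ((t : ℂ) - z))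
      simp only [Complex.sub_im, Complex.ofReal_im, zero_sub, neg_neg] at this
      exact hz.1.le.trans this
    have h2 : |t| ≤ ‖(t : ℂ) - z‖ + (‖z₀‖ + 1) := by
      have := norm_add_le ((t : ℂ) - z) z
      rw [sub_add_cancel, Complex.norm_real, Real.norm_eq_abs] at this
      have h3 : ‖z‖ < ‖z₀‖ + 1 := hz.2
      linarith
    set N := ‖(t : ℂ) - z‖
    have hN : 0 < N := lt_of_lt_of_le (by positivity) h1
    rw [norm_inv, norm_pow, inv_le_iff_one_le_mul₀ (by positivity), ← div_eq_mul_inv,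
      div_mul_eq_mul_div, one_le_div (by positivity)]
    have h4 : t ^ 2 ≤ 2 * N ^ 2 + 2 * (‖z₀‖ + 1) ^ 2 := by
      have := pow_le_pow_left₀ (abs_nonneg t) h2 2
      rw [sq_abs] at this
      nlinarith [sq_nonneg (N - (‖z₀‖ + 1))]
    have h5 : 1 ≤ N ^ 2 / (z₀.im / 2) ^ 2 := by
      rw [one_le_div (by positivity)]
      gcongr
    calc t ^ 2 + 1 ≤ 2 * N ^ 2 + (2 * (‖z₀‖ + 1) ^ 2 + 1) * 1 := by linarith
      _ ≤ 2 * N ^ 2 + (2 * (‖z₀‖ + 1) ^ 2 + 1) * (N ^ 2 / (z₀.im / 2) ^ 2) := by gcongr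
      _ = _ := by ring
  · have hz' : 0 < z.im := by
      have : z₀.im / 2 < z.im := hz.1
      linarith
    have := (((hasDerivAt_id z).const_sub (t : ℂ)).inv (hne z hz' t)).sub_const
      ((t : ℂ) / ((t : ℂ) ^ 2 + 1))
    simpa using this

lemma im_herglotzFn_nonneg {μ : Measure ℝ} (hμ : Integrable (fun t : ℝ => (t ^ 2 + 1)⁻¹) μ)
    (a : ℝ) {b : ℝ} (hb : 0 ≤ b) {z : ℂ} (hz : 0 < z.im) : 0 ≤ (herglotzFn μ a b z).im := by
  rw [im_herglotzFn hμ a b hz]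
  have : 0 ≤ ∫ t, halfPlanePoisson z.im (t - z.re) ∂μ :=
    integral_nonneg fun t => halfPlanePoisson_nonneg hz (t - z.re)
  positivity

lemma isLocallyFiniteMeasure_of_integrable_inv_sq_add_one {μ : Measure ℝ}
    (hμ : Integrable (fun t : ℝ => (t ^ 2 + 1)⁻¹) μ) : IsLocallyFiniteMeasure μ := by
  refine ⟨fun x => ⟨Set.Ioo (x - 1) (x + 1), Ioo_mem_nhds (by linarith) (by linarith), ?_⟩⟩
  refine (measure_mono (t := {t : ℝ | ((|x| + 1) ^ 2 + 1)⁻¹ ≤ ‖(t ^ 2 + 1)⁻¹‖}) ?_).trans_lt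
    (hμ.measure_norm_ge_lt_top (by positivity))
  intro t ht
  have h1 : |t| ≤ |x| + 1 := by
    have := abs_add_le (t - x) x
    have h2 : |t - x| ≤ 1 := abs_le.2 ⟨by linarith [ht.1], by linarith [ht.2]⟩
    rw [sub_add_cancel] at this
    linarith
  have h3 : t ^ 2 ≤ (|x| + 1) ^ 2 := by
    rw [← sq_abs t]; gcongr
  change _ ≤ ‖(t ^ 2 + 1)⁻¹‖
  rw [Real.norm_of_nonneg (by positivity)]
  gcongr

lemma measureReal_closedBall_le_im_herglotzFn {μ : Measure ℝ}
    (hμ : Integrable (fun t : ℝ => (t ^ 2 + 1)⁻¹) μ) (a : ℝ) {b : ℝ} (hb : 0 ≤ b)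
    (x : ℝ) {h y : ℝ} (hh : 0 < h) (hy : h ≤ y) :
    μ.real (Metric.closedBall x h) / (2 * y) ≤
      (herglotzFn μ a b (x + y * Complex.I)).im := by
  have := isLocallyFiniteMeasure_of_integrable_inv_sq_add_one hμ
  have hy0 : 0 < y := hh.trans_le hy
  have hz : 0 < (x + y * Complex.I : ℂ).im := by simpa using hy0
  rw [im_herglotzFn hμ a b hz]
  simp only [Complex.add_im, Complex.ofReal_im, Complex.mul_im, Complex.ofReal_re, Complex.I_im,
    mul_one, Complex.I_re, mul_zero, add_zero, zero_add, Complex.add_re, Complex.mul_re,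
    sub_self]
  have hfin : μ (Metric.closedBall x h) < ⊤ := (isCompact_closedBall x h).measure_lt_top
  have h1 : μ.real (Metric.closedBall x h) / (2 * y) ≤ ∫ t, halfPlanePoisson y (t - x) ∂μ := by
    calc _ = ∫ _ in Metric.closedBall x h, (2 * y)⁻¹ ∂μ := by
          simp [div_eq_mul_inv]
      _ ≤ ∫ t in Metric.closedBall x h, halfPlanePoisson y (t - x) ∂μ := by
          refine setIntegral_mono_on (integrableOn_const hfin.ne)
            (integrable_halfPlanePoisson_of_integrable hμ x hy0).integrableOn
            Metric.isClosed_closedBall.measurableSet fun t ht => ?_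
          rw [Metric.mem_closedBall, Real.dist_eq] at ht
          have h2 : (t - x) ^ 2 ≤ y ^ 2 := by
            rw [← sq_abs]; gcongr; exact ht.trans hy
          unfold halfPlanePoisson
          rw [inv_eq_one_div, div_le_div_iff₀ (by positivity) (by positivity)]
          nlinarith
      _ ≤ _ := setIntegral_le_integral (integrable_halfPlanePoisson_of_integrable hμ x hy0)
          (Eventually.of_forall fun t => halfPlanePoisson_nonneg hy0 _)
  have := mul_nonneg hb hy0.le
  linarith

lemma halfPlanePoisson_sub_comm (y s t : ℝ) :
    halfPlanePoisson y (s - t) = halfPlanePoisson y (t - s) := by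
  unfold halfPlanePoisson; ring

lemma continuous_herglotzFn_line {μ : Measure ℝ}
    (hμ : Integrable (fun t : ℝ => (t ^ 2 + 1)⁻¹) μ) (a b : ℝ) {y : ℝ} (hy : 0 < y) :
    Continuous fun t : ℝ => herglotzFn μ a b (t + y * Complex.I) :=
  (herglotzFn_differentiableOn hμ a b).continuousOn.comp_continuous (by fun_prop)
    fun t => by simpa using hy

lemma im_herglotzFn_line {μ : Measure ℝ} (hμ : Integrable (fun t : ℝ => (t ^ 2 + 1)⁻¹) μ)
    (a b : ℝ) {y : ℝ} (hy : 0 < y) (t : ℝ) :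
    (herglotzFn μ a b (t + y * Complex.I)).im =
      b * y + ∫ s, halfPlanePoisson y (s - t) ∂μ := by
  rw [im_herglotzFn hμ a b (by simpa using hy)]
  simp

lemma integrable_prod_halfPlanePoisson {μ : Measure ℝ}
    (hμ : Integrable (fun t : ℝ => (t ^ 2 + 1)⁻¹) μ) [SFinite μ] {K : Set ℝ} (hK : IsCompact K)
    {y : ℝ} (hy : 0 < y) :
    Integrable (Function.uncurry fun t s => halfPlanePoisson y (s - t))
      ((volume.restrict K).prod μ) := by
  have hm : Measurable (Function.uncurry fun t s => halfPlanePoisson y (s - t)) := by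
    unfold Function.uncurry
    exact (measurable_halfPlanePoisson y).comp (by fun_prop)
  refine (integrable_prod_iff hm.aestronglyMeasurable).2 ⟨Eventually.of_forall fun t =>
    integrable_halfPlanePoisson_of_integrable hμ t hy, ?_⟩
  have hc := (Complex.continuous_im.comp (continuous_herglotzFn_line hμ 0 0 hy)).continuousOn
    |>.integrableOn_compact (μ := volume) hK
  refine hc.congr (Eventually.of_forall fun t => ?_)
  simp only [Function.comp, im_herglotzFn_line hμ 0 0 hy, zero_mul, zero_add,
    Function.uncurry_apply_pair]
  exact integral_congr_ae (Eventually.of_forall fun s =>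
    (Real.norm_of_nonneg (halfPlanePoisson_nonneg hy _)).symm)

lemma setIntegral_halfPlanePoisson_le_pi (K : Set ℝ) {y : ℝ} (hy : 0 < y) (s : ℝ) :
    ∫ t in K, halfPlanePoisson y (s - t) ≤ Real.pi := by
  simp_rw [halfPlanePoisson_sub_comm y s]
  rw [← integral_halfPlanePoisson_sub hy s]
  exact setIntegral_le_integral (integrable_halfPlanePoisson_sub hy s)
    (Eventually.of_forall fun t => halfPlanePoisson_nonneg hy _)

lemma tendsto_setIntegral_halfPlanePoisson_of_notMem {K : Set ℝ} (hK : IsCompact K) {s : ℝ}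
    (hs : s ∉ K) :
    Tendsto (fun y => ∫ t in K, halfPlanePoisson y (s - t)) (𝓝[>] 0) (𝓝 0) := by
  obtain ⟨ε, hε, hball⟩ := Metric.isOpen_iff.1 hK.isClosed.isOpen_compl s hs
  have hlim : Tendsto (fun y : ℝ => y / ε ^ 2 * volume.real K) (𝓝[>] 0) (𝓝 0) := by
    have : Continuous fun y : ℝ => y / ε ^ 2 * volume.real K := by fun_prop
    simpa using (this.tendsto 0).mono_left nhdsWithin_le_nhds
  refine squeeze_zero_norm' ?_ hlim
  filter_upwards [self_mem_nhdsWithin] with y hy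
  replace hy : 0 < y := hy
  refine norm_setIntegral_le_of_norm_le_const hK.measure_lt_top fun t ht => ?_
  rw [Real.norm_of_nonneg (halfPlanePoisson_nonneg hy _)]
  have h1 : ε ≤ |s - t| := by
    by_contra! hlt
    exact hball (by rwa [Metric.mem_ball, dist_comm, Real.dist_eq]) ht
  have h2 : ε ^ 2 ≤ (s - t) ^ 2 := by
    rw [← sq_abs (s - t)]; gcongr
  unfold halfPlanePoisson
  gcongr
  nlinarith

lemma setIntegral_halfPlanePoisson_le {K : Set ℝ} (hK : IsCompact K) {R : ℝ}
    (hR : K ⊆ Metric.closedBall 0 R) {y : ℝ} (hy : 0 < y) (hy1 : y ≤ 1) (s : ℝ) :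
    ∫ t in K, halfPlanePoisson y (s - t) ≤
      (2 * volume.real K + (2 * R ^ 2 + 1) * Real.pi) * (s ^ 2 + 1)⁻¹ := by
  have hi : IntegrableOn (fun t => halfPlanePoisson y (s - t)) K := by
    simp_rw [halfPlanePoisson_sub_comm y s]
    exact (integrable_halfPlanePoisson_sub hy s).integrableOn
  rw [← div_eq_mul_inv, le_div_iff₀ (by positivity), mul_comm, ← integral_const_mul]
  calc ∫ t in K, (s ^ 2 + 1) * halfPlanePoisson y (s - t)
      ≤ ∫ t in K, (2 + (2 * R ^ 2 + 1) * halfPlanePoisson y (s - t)) := by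
        refine setIntegral_mono_on (hi.const_mul _)
          ((integrableOn_const hK.measure_lt_top.ne).add (hi.const_mul _)) hK.measurableSet ?_
        intro t ht
        have h1 : |t| ≤ R := by simpa using hR ht
        have h2 : t ^ 2 ≤ R ^ 2 := by
          rw [← sq_abs t]; gcongr
        have h3 : s ^ 2 ≤ 2 * (s - t) ^ 2 + 2 * R ^ 2 := by
          nlinarith [sq_nonneg (s - 2 * t)]
        have h4 : (s - t) ^ 2 * halfPlanePoisson y (s - t) ≤ 1 := by
          unfold halfPlanePoisson
          rw [← mul_div_assoc, div_le_one (by positivity)]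
          nlinarith [sq_nonneg (s - t), sq_nonneg y]
        have h5 := mul_le_mul_of_nonneg_right h3 (halfPlanePoisson_nonneg hy (s - t))
        linarith
    _ = 2 * volume.real K + (2 * R ^ 2 + 1) * ∫ t in K, halfPlanePoisson y (s - t) := by
        have h2 : Integrable (fun _ : ℝ => (2 : ℝ)) (volume.restrict K) :=
          integrableOn_const hK.measure_lt_top.ne
        rw [integral_add h2 (hi.const_mul _), integral_const_mul]
        simp [mul_comm]
    _ ≤ _ := by
        gcongr
        exact setIntegral_halfPlanePoisson_le_pi K hy s

/-- The Poisson extensions of `μ` have asymptotically at most mass `π μ(K)` on a compact set. -/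
lemma exists_tendsto_setIntegral_poisson_le {μ : Measure ℝ}
    (hμ : Integrable (fun t : ℝ => (t ^ 2 + 1)⁻¹) μ) {K : Set ℝ} (hK : IsCompact K) :
    ∃ G : ℝ → ℝ, Tendsto G (𝓝[>] 0) (𝓝 (Real.pi * μ.real K)) ∧
      ∀ y, 0 < y → y ≤ 1 → ∫ t in K, ∫ s, halfPlanePoisson y (s - t) ∂μ ≤ G y := by
  classical
  have := isLocallyFiniteMeasure_of_integrable_inv_sq_add_one hμ
  obtain ⟨R, hR⟩ := hK.isBounded.subset_closedBall 0
  let ψ : ℝ → ℝ → ℝ := fun y =>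
    K.piecewise (fun _ => Real.pi) fun s => ∫ t in K, halfPlanePoisson y (s - t)
  let B : ℝ → ℝ := fun s => (2 * volume.real K + (2 * R ^ 2 + 1) * Real.pi) * (s ^ 2 + 1)⁻¹
  have hB : Integrable B μ := hμ.const_mul _
  have hmeas : ∀ y, 0 < y → AEStronglyMeasurable (ψ y) μ := by
    intro y hy
    refine AEStronglyMeasurable.piecewise hK.measurableSet (by fun_prop) ?_
    exact (integrable_prod_halfPlanePoisson hμ hK hy).swap.integral_prod_left
      |>.aestronglyMeasurable.restrict
  have hbound : ∀ y, 0 < y → y ≤ 1 → ∀ s, ‖ψ y s‖ ≤ B s := by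
    intro y hy hy1 s
    by_cases hs : s ∈ K
    · simp only [ψ, B, Set.piecewise_eq_of_mem _ _ _ hs]
      rw [Real.norm_of_nonneg Real.pi_pos.le, ← div_eq_mul_inv, le_div_iff₀ (by positivity)]
      have h1 : |s| ≤ R := by simpa using hR hs
      have h2 : s ^ 2 ≤ R ^ 2 := by
        rw [← sq_abs s]; gcongr
      have h3 : 0 ≤ volume.real K := measureReal_nonneg
      nlinarith [Real.pi_pos, sq_nonneg R]
    · simp only [ψ, B, Set.piecewise_eq_of_notMem _ _ _ hs]
      rw [Real.norm_of_nonneg (integral_nonneg fun t => halfPlanePoisson_nonneg hy _)]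
      exact setIntegral_halfPlanePoisson_le hK hR hy hy1 s
  refine ⟨fun y => ∫ s, ψ y s ∂μ, ?_, ?_⟩
  · have hlim : ∫ s, K.indicator (fun _ => Real.pi) s ∂μ = Real.pi * μ.real K := by
      rw [integral_indicator hK.measurableSet]
      simp [mul_comm]
    rw [← hlim]
    have hev : ∀ᶠ y : ℝ in 𝓝[>] 0, 0 < y ∧ y ≤ 1 := by
      filter_upwards [Ioo_mem_nhdsGT (zero_lt_one' ℝ)] with y hy using ⟨hy.1, hy.2.le⟩
    refine tendsto_integral_filter_of_dominated_convergence B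
      (hev.mono fun y hy => hmeas y hy.1)
      (hev.mono fun y hy => Eventually.of_forall (hbound y hy.1 hy.2)) hB
      (Eventually.of_forall fun s => ?_)
    by_cases hs : s ∈ K
    · simp only [ψ, Set.piecewise_eq_of_mem _ _ _ hs, Set.indicator_of_mem hs]
      exact tendsto_const_nhds
    · simp only [ψ, Set.piecewise_eq_of_notMem _ _ _ hs, Set.indicator_of_notMem hs]
      exact tendsto_setIntegral_halfPlanePoisson_of_notMem hK hs
  · intro y hy hy1
    rw [integral_integral_swap (integrable_prod_halfPlanePoisson hμ hK hy)]
    refine integral_mono_of_nonneg (Eventually.of_forall fun s =>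
      integral_nonneg fun t => halfPlanePoisson_nonneg hy _)
      (hB.mono' (hmeas y hy) (Eventually.of_forall (hbound y hy hy1)))
      (Eventually.of_forall fun s => ?_)
    by_cases hs : s ∈ K
    · simp only [ψ, Set.piecewise_eq_of_mem _ _ _ hs]
      exact setIntegral_halfPlanePoisson_le_pi K hy s
    · simp only [ψ, Set.piecewise_eq_of_notMem _ _ _ hs]
      exact le_rfl

lemma re_I_mul_div_add (w : ℂ) (L : ℝ) :
    (Complex.I * L / (w + Complex.I * L)).re =
      L * (w.im + L) / (w.re ^ 2 + (w.im + L) ^ 2) := by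
  simp only [Complex.div_re, Complex.normSq_apply, Complex.mul_re, Complex.mul_im, Complex.I_re,
    Complex.I_im, Complex.ofReal_re, Complex.ofReal_im, Complex.add_re, Complex.add_im]
  ring

lemma norm_I_mul_div_add_le {w : ℂ} (hw : 0 ≤ w.im) {L : ℝ} (hL : 0 < L) :
    ‖Complex.I * L / (w + Complex.I * L)‖ ≤ L / (w.im + L) := by
  have h1 : w.im + L ≤ ‖w + Complex.I * L‖ := by
    have := (le_abs_self _).trans (Complex.abs_im_le_norm (w + Complex.I * L))
    simpa using this
  rw [norm_div]
  simp only [norm_mul, Complex.norm_I, one_mul, Complex.norm_real, Real.norm_of_nonneg hL.le]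
  gcongr

lemma one_le_im_div_add_re_I_mul_div_add {w : ℂ} (hw : 0 ≤ w.im) {L : ℝ} (hL : 0 < L) :
    1 ≤ w.im / L + (Complex.I * L / (w + Complex.I * L)).re + min 1 (w.re ^ 2 / L ^ 2) := by
  rw [re_I_mul_div_add]
  set r := w.re
  set v := w.im
  have hv : 0 ≤ v / L := by positivity
  have hu : 0 ≤ L * (v + L) / (r ^ 2 + (v + L) ^ 2) := by positivity
  rcases min_cases 1 (r ^ 2 / L ^ 2) with ⟨h, _⟩ | ⟨h, _⟩
  · rw [h]; linarith
  · rw [h]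
    have h1 : L / (v + L) - r ^ 2 / L ^ 2 ≤ L * (v + L) / (r ^ 2 + (v + L) ^ 2) := by
      have h2 : L / (v + L) - L * (v + L) / (r ^ 2 + (v + L) ^ 2) =
          r ^ 2 * (L / ((v + L) * (r ^ 2 + (v + L) ^ 2))) := by
        field_simp
        ring
      have h3 : L / ((v + L) * (r ^ 2 + (v + L) ^ 2)) ≤ 1 / L ^ 2 := by
        calc _ ≤ L / (L * (0 + L ^ 2)) := by gcongr <;> nlinarith [sq_nonneg r]
          _ = _ := by field_simp; ring
      have := mul_le_mul_of_nonneg_left h3 (sq_nonneg r)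
      rw [mul_one_div] at this
      linarith
    have h4 : 1 - v / L ≤ L / (v + L) := by
      rw [le_div_iff₀ (by positivity)]
      have : (1 - v / L) * (v + L) = L - v ^ 2 / L := by field_simp; ring
      rw [this]
      have : 0 ≤ v ^ 2 / L := by positivity
      linarith
    linarith

/-- If `Re F` vanishes on the compact set `K ⊆ [x - h, x + h]`, then the size of `K` is controlled
by the masses of `K` and of `[x - h, x + h]`. -/
lemma volume_real_le_of_reflectionless {μ : Measure ℝ}
    (hμ : Integrable (fun t : ℝ => (t ^ 2 + 1)⁻¹) μ) (a : ℝ) {b : ℝ} (hb : 0 ≤ b)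
    {K : Set ℝ} (hK : IsCompact K) {x h : ℝ} (hh : 0 < h) (hKx : K ⊆ Metric.closedBall x h)
    (hre : ∀ᵐ t : ℝ ∂(volume.restrict K),
      Tendsto (fun y : ℝ => (herglotzFn μ a b ((t : ℂ) + y * Complex.I)).re)
        (𝓝[>] (0 : ℝ)) (𝓝 0))
    (hm : 0 < μ.real (Metric.closedBall x h)) {L : ℝ} (hL : 0 < L) :
    volume.real K ≤ Real.pi * μ.real K / L +
      4 * Real.pi * h ^ 2 * L / μ.real (Metric.closedBall x h) := by
  set m := μ.real (Metric.closedBall x h)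
  set F := herglotzFn μ a b
  obtain ⟨G, hG, hGle⟩ := exists_tendsto_setIntegral_poisson_le hμ hK
  have hFim : ∀ z : ℂ, 0 < z.im → 0 ≤ (F z).im := fun z hz => im_herglotzFn_nonneg hμ a hb hz
  let g : ℂ → ℂ := fun z => Complex.I * L / (F z + Complex.I * L)
  have hFne : ∀ z : ℂ, 0 < z.im → F z + Complex.I * L ≠ 0 := fun z hz h0 => by
    have h1 := congrArg Complex.im h0
    simp at h1
    linarith [hFim z hz]
  have hg : DifferentiableOn ℂ g {z | 0 < z.im} :=
    (differentiableOn_const _).div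
      ((herglotzFn_differentiableOn hμ a b).add_const _) fun z hz => hFne z hz
  have hg1 : ∀ z : ℂ, 0 < z.im → ‖g z‖ ≤ 1 := fun z hz =>
    (norm_I_mul_div_add_le (hFim z hz) hL).trans
      (div_le_one_of_le₀ (by linarith [hFim z hz]) (by linarith [hFim z hz]))
  have hgre : ∀ z : ℂ, 0 < z.im → 0 ≤ (g z).re := fun z hz => by
    have := hFim z hz
    simp only [g]
    rw [re_I_mul_div_add]
    positivity
  have hline : ∀ y : ℝ, 0 < y → ∀ t : ℝ, 0 < ((t : ℂ) + y * Complex.I).im :=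
    fun y hy t => by simpa using hy
  have hgc : ∀ y : ℝ, 0 < y → Continuous fun t : ℝ => g (t + y * Complex.I) := fun y hy =>
    hg.continuousOn.comp_continuous (by fun_prop) (hline y hy)
  have hFc : ∀ y : ℝ, 0 < y → Continuous fun t : ℝ => F (t + y * Complex.I) := fun y hy =>
    continuous_herglotzFn_line hμ a b hy
  let ρ : ℝ → ℝ → ℝ := fun y t => min 1 ((F (t + y * Complex.I)).re ^ 2 / L ^ 2)
  have hρc : ∀ y : ℝ, 0 < y → Continuous (ρ y) := fun y hy =>
    continuous_const.min (((Complex.continuous_re.comp (hFc y hy)).pow 2).div_const _)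
  have hKfin : volume K < ⊤ := hK.measure_lt_top
  have hρlim : Tendsto (fun y => ∫ t in K, ρ y t) (𝓝[>] 0) (𝓝 0) := by
    have : Tendsto (fun y => ∫ t in K, ρ y t) (𝓝[>] 0) (𝓝 (∫ t in K, (0 : ℝ))) := by
      refine tendsto_integral_filter_of_dominated_convergence (fun _ => 1) ?_ ?_
        (integrableOn_const hKfin.ne) ?_
      · filter_upwards [self_mem_nhdsWithin] with y hy
        exact (hρc y hy).aestronglyMeasurable
      · refine Eventually.of_forall fun y => Eventually.of_forall fun t => ?_
        rw [Real.norm_of_nonneg (by positivity)]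
        exact min_le_left _ _
      · filter_upwards [hre] with t ht
        have h1 := (tendsto_const_nhds (x := (1 : ℝ))).min ((ht.pow 2).div_const (L ^ 2))
        simpa using h1
    simpa using this
  have hkey : ∀ y : ℝ, 0 < y → y ≤ 1 → volume.real K ≤
      (b * y * volume.real K + G y) / L + 4 * Real.pi * h * (y + h) * L / m +
        ∫ t in K, ρ y t := by
    intro y hy hy1
    have hImc : IntegrableOn (fun t : ℝ => (F (t + y * Complex.I)).im) K :=
      (Complex.continuous_im.comp (hFc y hy)).continuousOn.integrableOn_compact hK
    have hRec : IntegrableOn (fun t : ℝ => (g (t + y * Complex.I)).re) K :=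
      (Complex.continuous_re.comp (hgc y hy)).continuousOn.integrableOn_compact hK
    have hρi : IntegrableOn (ρ y) K := (hρc y hy).continuousOn.integrableOn_compact hK
    have h1 : volume.real K ≤ (∫ t in K, (F (t + y * Complex.I)).im) / L +
        (∫ t in K, (g (t + y * Complex.I)).re) + ∫ t in K, ρ y t := by
      calc volume.real K = ∫ _ in K, (1 : ℝ) := by simp
        _ ≤ ∫ t in K, ((F (t + y * Complex.I)).im / L + (g (t + y * Complex.I)).re + ρ y t) :=
          setIntegral_mono (integrableOn_const hKfin.ne)
            (((hImc.div_const L).add hRec).add hρi) fun t =>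
              one_le_im_div_add_re_I_mul_div_add (hFim _ (hline y hy t)) hL
        _ = _ := by
          have hsum : Integrable (fun t : ℝ => (F (t + y * Complex.I)).im / L +
              (g (t + y * Complex.I)).re) (volume.restrict K) := (hImc.div_const L).add hRec
          rw [integral_add hsum hρi, integral_add (hImc.div_const L) hRec, integral_div]
    have h2 : ∫ t in K, (F (t + y * Complex.I)).im ≤ b * y * volume.real K + G y := by
      have hc : Integrable (fun _ : ℝ => b * y) (volume.restrict K) :=
        integrableOn_const hKfin.ne
      have e : ∀ t : ℝ, (F (t + y * Complex.I)).im =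
          b * y + ∫ s, halfPlanePoisson y (s - t) ∂μ := im_herglotzFn_line hμ a b hy
      have hp : Integrable (fun t => ∫ s, halfPlanePoisson y (s - t) ∂μ)
          (volume.restrict K) := by
        refine (hImc.sub hc).congr (Eventually.of_forall fun t => ?_)
        simp [e]
      simp_rw [e]
      rw [integral_add hc hp]
      have : ∫ _ in K, b * y = b * y * volume.real K := by simp [mul_comm]
      rw [this]
      gcongr
      exact hGle y hy hy1
    have h3 : ∫ t in K, (g (t + y * Complex.I)).re ≤ 4 * Real.pi * h * (y + h) * L / m := by
      have hP := integral_halfPlanePoisson_smul_of_bounded hg hg1 x hh hy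
      have hPi : Integrable fun t : ℝ =>
          (halfPlanePoisson h (t - x) : ℂ) * g (t + y * Complex.I) := by
        refine (integrable_halfPlanePoisson_sub hh x).mono' ?_ (Eventually.of_forall fun t => ?_)
        · refine (Continuous.mul ?_ (hgc y hy)).aestronglyMeasurable
          exact Complex.continuous_ofReal.comp
            ((continuous_halfPlanePoisson hh).comp (by fun_prop))
        · rw [norm_mul, Complex.norm_real,
            Real.norm_of_nonneg (halfPlanePoisson_nonneg hh _)]
          exact mul_le_of_le_one_right (halfPlanePoisson_nonneg hh _) (hg1 _ (hline y hy t))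
      have hPre : ∫ t : ℝ, halfPlanePoisson h (t - x) * (g (t + y * Complex.I)).re =
          Real.pi * (g (x + (y + h : ℝ) * Complex.I)).re := by
        have := Complex.reCLM.integral_comp_comm hPi
        simp only [Complex.reCLM_apply, Complex.re_ofReal_mul] at this
        rw [this, hP, Complex.re_ofReal_mul]
      have hPrei : Integrable fun t : ℝ =>
          halfPlanePoisson h (t - x) * (g (t + y * Complex.I)).re := by
        refine hPi.re.congr (Eventually.of_forall fun t => ?_)
        exact Complex.re_ofReal_mul _ _
      have hz : 0 < ((x : ℂ) + (y + h : ℝ) * Complex.I).im := hline (y + h) (by linarith) x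
      have hM : m / (2 * (y + h)) ≤ (F (x + (y + h : ℝ) * Complex.I)).im :=
        measureReal_closedBall_le_im_herglotzFn hμ a hb x hh (by linarith)
      calc ∫ t in K, (g (t + y * Complex.I)).re
          ≤ ∫ t in K, 2 * h * (halfPlanePoisson h (t - x) * (g (t + y * Complex.I)).re) := by
            refine setIntegral_mono_on hRec (hPrei.const_mul _).integrableOn hK.measurableSet
              fun t ht => ?_
            have ht' := hKx ht
            rw [Metric.mem_closedBall, Real.dist_eq] at ht'
            have e1 : (t - x) ^ 2 ≤ h ^ 2 := by
              rw [← sq_abs]; gcongr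
            have e2 : 1 ≤ 2 * h * halfPlanePoisson h (t - x) := by
              unfold halfPlanePoisson
              rw [← mul_div_assoc, one_le_div (by positivity)]
              nlinarith
            rw [← mul_assoc]
            exact le_mul_of_one_le_left (hgre _ (hline y hy t)) e2
        _ ≤ ∫ t, 2 * h * (halfPlanePoisson h (t - x) * (g (t + y * Complex.I)).re) := by
            refine setIntegral_le_integral (hPrei.const_mul _) (Eventually.of_forall fun t => ?_)
            have e1 := halfPlanePoisson_nonneg hh (t - x)
            have e2 := hgre _ (hline y hy t)
            exact mul_nonneg (by positivity) (mul_nonneg e1 e2)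
        _ = 2 * h * (Real.pi * (g (x + (y + h : ℝ) * Complex.I)).re) := by
            rw [integral_const_mul, hPre]
        _ ≤ 2 * h * (Real.pi * (L / (m / (2 * (y + h))))) := by
            gcongr
            refine (Complex.re_le_norm _).trans ((norm_I_mul_div_add_le (hFim _ hz) hL).trans ?_)
            gcongr
            linarith
        _ = _ := by field_simp; ring
    calc _ ≤ _ := h1
      _ ≤ _ := by gcongr
  have hlim : Tendsto (fun y => (b * y * volume.real K + G y) / L +
      4 * Real.pi * h * (y + h) * L / m + ∫ t in K, ρ y t) (𝓝[>] 0)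
      (𝓝 ((b * 0 * volume.real K + Real.pi * μ.real K) / L +
        4 * Real.pi * h * (0 + h) * L / m + 0)) := by
    have hid : Tendsto (fun y : ℝ => y) (𝓝[>] 0) (𝓝 0) := nhdsWithin_le_nhds
    exact (((((hid.const_mul b).mul_const _).add hG).div_const L).add
      ((((hid.add_const h).const_mul _).mul_const L).div_const m)).add hρlim
  have := ge_of_tendsto hlim (by
    filter_upwards [Ioo_mem_nhdsGT (zero_lt_one' ℝ)] with y hy using hkey y hy.1 hy.2.le)
  calc _ ≤ _ := this
    _ = _ := by ring

lemma volume_real_inter_closedBall_le {E : Set ℝ} (hE : MeasurableSet E) {μ : Measure ℝ}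
    (hμ : IsReflectionless μ E) {x h : ℝ} (hh : 0 < h)
    (hm : 0 < (μ.singularPart volume).real (Metric.closedBall x h)) {L : ℝ} (hL : 0 < L) :
    volume.real (E ∩ Metric.closedBall x h) ≤
      Real.pi * (volume.withDensity (μ.rnDeriv volume)).real (Metric.closedBall x h) / L +
        4 * Real.pi * h ^ 2 * L / (μ.singularPart volume).real (Metric.closedBall x h) := by
  obtain ⟨hint, a, b, hb, hre⟩ := hμ
  have := isLocallyFiniteMeasure_of_integrable_inv_sq_add_one hint
  have hdec := μ.haveLebesgueDecomposition_add volume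
  set σ := μ.singularPart volume
  set α := volume.withDensity (μ.rnDeriv volume)
  set B := Metric.closedBall x h
  have hfin : μ B < ⊤ := (isCompact_closedBall x h).measure_lt_top
  have hαμ : α ≤ μ := by rw [hdec]; exact Measure.le_add_left le_rfl
  have hσμ : σ ≤ μ := by rw [hdec]; exact Measure.le_add_right le_rfl
  have hms : σ ⟂ₘ volume := μ.mutuallySingular_singularPart volume
  have hσB : σ.real B ≤ μ.real B := ENNReal.toReal_mono hfin.ne (hσμ B)
  have hvB : volume B < ⊤ := (isCompact_closedBall x h).measure_lt_top
  have hAeq : volume (E ∩ B ∩ hms.nullSet) = volume (E ∩ B) := by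
    refine measure_inter_conull' ?_
    exact measure_mono_null (fun t ht => ht.2) hms.measure_compl_nullSet
  have hAmeas : MeasurableSet (E ∩ B ∩ hms.nullSet) :=
    (hE.inter Metric.isClosed_closedBall.measurableSet).inter hms.measurableSet_nullSet
  by_contra! hlt
  have hlt' : ENNReal.ofReal (Real.pi * α.real B / L + 4 * Real.pi * h ^ 2 * L / σ.real B) <
      volume (E ∩ B ∩ hms.nullSet) := by
    rw [hAeq]
    exact (ENNReal.ofReal_lt_iff_lt_toReal (by positivity)
      (measure_ne_top_of_subset Set.inter_subset_right hvB.ne)).2 hlt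
  obtain ⟨K, hKA, hK, hKlt⟩ := hAmeas.exists_lt_isCompact hlt'
  have hKlt' := (ENNReal.ofReal_lt_iff_lt_toReal (by positivity) hK.measure_lt_top.ne).1 hKlt
  have hKB : K ⊆ B := fun t ht => (hKA ht).1.2
  have hKle : μ.real K ≤ α.real B := by
    refine ENNReal.toReal_mono ((hαμ B).trans_lt hfin).ne ?_
    calc μ K = σ K + α K := by conv_lhs => rw [hdec, Measure.add_apply]
      _ = α K := by
        rw [measure_mono_null (fun t ht => (hKA ht).2) hms.measure_nullSet, zero_add]
      _ ≤ α B := measure_mono hKB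
  have := volume_real_le_of_reflectionless hint a hb hK hh hKB
    (ae_restrict_of_ae_restrict_of_subset (fun t ht => (hKA ht).1.1) hre) (hm.trans_le hσB) hL
  have h2 : Real.pi * μ.real K / L + 4 * Real.pi * h ^ 2 * L / μ.real B ≤
      Real.pi * α.real B / L + 4 * Real.pi * h ^ 2 * L / σ.real B := by
    gcongr
  exact absurd (hKlt'.trans_le (this.trans h2)) (lt_irrefl _)

/-- Theorem 1.1(a): if `μ ∈ R(E)`, then the singular part of `μ` is supported by the set
of points `x` where `|E ∩ (x-h, x+h)|/(2h) → 0` as `h → 0+`. -/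
theorem singularPart_supported_on_density_zero_points
    (E : Set ℝ) (hE : MeasurableSet E) (μ : Measure ℝ) (hμ : IsReflectionless μ E) :
    μ.singularPart volume
      {x : ℝ | ¬ Tendsto
        (fun h : ℝ => (volume (E ∩ Set.Ioo (x - h) (x + h))).toReal / (2 * h))
        (𝓝[>] (0 : ℝ)) (𝓝 0)} = 0 := by
  have := isLocallyFiniteMeasure_of_integrable_inv_sq_add_one hμ.1
  have hbound := fun x h (hh : 0 < h) hm L (hL : 0 < L) =>
    volume_real_inter_closedBall_le hE hμ (x := x) hh hm hL
  have hdec := μ.haveLebesgueDecomposition_add volume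
  have hms : volume.withDensity (μ.rnDeriv volume) ⟂ₘ μ.singularPart volume :=
    (μ.mutuallySingular_singularPart volume).symm.mono_ac
      (withDensity_absolutelyContinuous _ _) Measure.AbsolutelyContinuous.rfl
  set σ := μ.singularPart volume
  set α := volume.withDensity (μ.rnDeriv volume)
  have hαμ : α ≤ μ := by rw [hdec]; exact Measure.le_add_left le_rfl
  have hσμ : σ ≤ μ := by rw [hdec]; exact Measure.le_add_right le_rfl
  have : IsLocallyFiniteMeasure α := Measure.isLocallyFiniteMeasure_of_le hαμ
  have : IsLocallyFiniteMeasure σ := Measure.isLocallyFiniteMeasure_of_le hσμ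
  refine ae_iff.1 ?_
  filter_upwards [Besicovitch.ae_tendsto_rnDeriv α σ, hms.rnDeriv_ae_eq_zero,
    (Besicovitch.vitaliFamily σ).ae_eventually_measure_pos] with x hx hx0 hpos
  replace hpos := (Besicovitch.tendsto_filterAt σ x).eventually hpos
  rw [hx0, Pi.zero_apply] at hx
  have hq : Tendsto (fun h => α.real (Metric.closedBall x h) / σ.real (Metric.closedBall x h))
      (𝓝[>] 0) (𝓝 0) := by
    have := (ENNReal.tendsto_toReal ENNReal.zero_ne_top).comp hx
    refine this.congr fun h => ?_
    simp [ENNReal.toReal_div, Measure.real]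
  rw [Metric.tendsto_nhds]
  intro ε hε
  set κ := ε / (4 * Real.pi) with hκ
  have hκ0 : 0 < κ := by positivity
  have hq' := hq.const_mul (Real.pi / (2 * κ))
  rw [mul_zero] at hq'
  filter_upwards [hpos, hq'.eventually_lt_const (half_pos hε), self_mem_nhdsWithin]
    with h hσ hlt hh
  replace hh : 0 < h := hh
  have hσ' : 0 < σ.real (Metric.closedBall x h) :=
    ENNReal.toReal_pos hσ.ne' (isCompact_closedBall x h).measure_lt_top.ne
  rw [Real.dist_eq, sub_zero, abs_of_nonneg (by positivity)]
  have h1 := hbound x h hh hσ' (κ * σ.real (Metric.closedBall x h) / h) (by positivity)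
  have h2 : (volume (E ∩ Set.Ioo (x - h) (x + h))).toReal ≤
      volume.real (E ∩ Metric.closedBall x h) := by
    refine ENNReal.toReal_mono (measure_ne_top_of_subset Set.inter_subset_right
      (isCompact_closedBall x h).measure_lt_top.ne) (measure_mono ?_)
    rw [← Real.ball_eq_Ioo]
    exact Set.inter_subset_inter_right _ Metric.ball_subset_closedBall
  calc _ ≤ (Real.pi * α.real (Metric.closedBall x h) /
          (κ * σ.real (Metric.closedBall x h) / h) + 4 * Real.pi * h ^ 2 *
          (κ * σ.real (Metric.closedBall x h) / h) / σ.real (Metric.closedBall x h)) /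
          (2 * h) := by gcongr; exact h2.trans h1
    _ = Real.pi / (2 * κ) * (α.real (Metric.closedBall x h) / σ.real (Metric.closedBall x h)) +
          2 * Real.pi * κ := by field_simp; ring
    _ < ε / 2 + ε / 2 := by
        refine add_lt_add_of_lt_of_le hlt (le_of_eq ?_)
        rw [hκ]; field_simp; ring
    _ = ε := add_halves ε
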